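/- For any ε, M > 0 and m ≥ 2 there exists δ > 0 with the following property: if A is a real m×m matrix with trace zero such that |e_i · A e_i| < δ for each i ∈ {1,…,m}, ‖A‖ ≤ M, and ‖A_sym^{-1}‖ ≤ M where A_sym = (A+Aᵀ)/2, then there exists an m×m orthogonal matrix U such that Â := Uᵀ A U has all diagonal entries zero and ‖Â − A‖ < ε. -/

import Mathlib

open scoped Matrix
open Filter Topology

/-- A real quadratic `τ + x t + κ t²` whose extreme coefficients have opposite signs has a root that
is small when `τ` is small compared with `κ` or with `x`. -/
lemma exists_small_root_of_mul_nonpos {τ x κ : ℝ} (h : τ * κ ≤ 0) (hne : κ ≠ 0 ∨ x ≠ 0) :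
    ∃ t : ℝ, τ + t * x + t ^ 2 * κ = 0 ∧ |x| * |t| ≤ |τ| ∧ |κ| * t ^ 2 ≤ |τ| := by
  wlog hτ : 0 ≤ τ generalizing τ x κ
  · obtain ⟨t, h0, h1, h2⟩ := this (τ := -τ) (x := -x) (κ := -κ) (by linarith)
      (by simpa using hne) (by linarith)
    exact ⟨t, by linarith, by simpa using h1, by simpa using h2⟩
  wlog hx : 0 ≤ x generalizing x
  · obtain ⟨t, h0, h1, h2⟩ := this (x := -x) (by simpa using hne) (by linarith)
    exact ⟨-t, by linarith, by simpa using h1, by simpa using h2⟩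
  rcases hτ.eq_or_lt with rfl | hτ
  · exact ⟨0, by simp⟩
  have hκ : κ ≤ 0 := by nlinarith
  suffices ∃ t : ℝ, t ≤ 0 ∧ τ + t * x + t ^ 2 * κ = 0 by
    obtain ⟨t, ht, h0⟩ := this
    refine ⟨t, h0, ?_, ?_⟩
    · rw [abs_of_nonneg hx, abs_of_nonpos ht, abs_of_pos hτ]
      nlinarith [sq_nonneg t]
    · rw [abs_of_nonpos hκ, abs_of_pos hτ]
      nlinarith
  have hpos : 0 < x - κ := by
    rcases hne with h | h
    · have := lt_of_le_of_ne hκ h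
      linarith
    · have := lt_of_le_of_ne hx h.symm
      linarith
  set a := 1 + τ / (x - κ) with ha
  have hq : 0 < τ / (x - κ) := by positivity
  have hval : τ + (-a) * x + (-a) ^ 2 * κ ≤ 0 := by
    have h1 : τ = (a - 1) * (x - κ) := by rw [ha]; field_simp; ring
    have h2 : 1 < a := by linarith
    nlinarith [mul_nonneg (sub_nonneg.2 h2.le) (sub_nonneg.2 h2.le), mul_nonneg (neg_nonneg.2 hκ) (sub_pos.2 h2).le,
      mul_nonneg (neg_nonneg.2 hκ) (sq_nonneg (a - 1))]
  have hcont : ContinuousOn (fun t : ℝ => τ + t * x + t ^ 2 * κ) (Set.Icc (-a) 0) := by fun_prop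
  obtain ⟨t, ht, h0⟩ := intermediate_value_Icc (by linarith) hcont
    (show (0 : ℝ) ∈ Set.Icc _ _ from ⟨hval, by simpa using hτ.le⟩)
  exact ⟨t, ht.2, h0⟩

/-- The rotation of the plane spanned by the orthonormal vectors `e`, `u` that sends `e` to the
normalization of `e + t u`, extended by the identity. -/
noncomputable def planeRotation {n : Type*} [DecidableEq n] (e u : n → ℝ) (t : ℝ) :
    Matrix n n ℝ :=
  1 + ((√(1 + t ^ 2))⁻¹ - 1) • (Matrix.vecMulVec e e + Matrix.vecMulVec u u) +
    (t * (√(1 + t ^ 2))⁻¹) • (Matrix.vecMulVec u e - Matrix.vecMulVec e u)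

section planeRotation

variable {n : Type*} [DecidableEq n] {e u : n → ℝ}

lemma continuous_planeRotation : Continuous (planeRotation e u) := by
  have h : ∀ t : ℝ, √(1 + t ^ 2) ≠ 0 := fun t => (Real.sqrt_pos.2 (by positivity)).ne'
  unfold planeRotation
  fun_prop (disch := exact h _)

lemma planeRotation_zero : planeRotation e u 0 = 1 := by
  simp [planeRotation]

variable [Fintype n]

lemma planeRotation_mul_transpose (he : e ⬝ᵥ e = 1) (hu : u ⬝ᵥ u = 1) (heu : e ⬝ᵥ u = 0)
    (t : ℝ) : planeRotation e u t * (planeRotation e u t)ᵀ = 1 := by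
  have hue : u ⬝ᵥ e = 0 := by rw [dotProduct_comm, heu]
  have hc : ((√(1 + t ^ 2))⁻¹) ^ 2 * (1 + t ^ 2) = 1 := by
    rw [inv_pow, Real.sq_sqrt (by positivity), inv_mul_cancel₀ (by positivity)]
  unfold planeRotation
  generalize (√(1 + t ^ 2))⁻¹ = c at hc
  simp only [Matrix.transpose_add, Matrix.transpose_sub, Matrix.transpose_smul,
    Matrix.transpose_one, Matrix.transpose_vecMulVec, mul_add, add_mul, mul_sub, sub_mul,
    Matrix.smul_mul, Matrix.mul_smul, Matrix.vecMulVec_mul_vecMulVec, he, hu, heu, hue, one_mul,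
    mul_one, one_smul, zero_smul, Matrix.vecMulVec_zero, smul_zero, smul_add, smul_sub]
  ext i j
  simp only [Matrix.add_apply, Matrix.sub_apply, Matrix.smul_apply, Matrix.vecMulVec_apply,
    smul_eq_mul]
  simp
  linear_combination (e i * e j + u i * u j) * hc

lemma planeRotation_mulVec_left (he : e ⬝ᵥ e = 1) (heu : e ⬝ᵥ u = 0) (t : ℝ) :
    planeRotation e u t *ᵥ e = (√(1 + t ^ 2))⁻¹ • (e + t • u) := by
  have hue : u ⬝ᵥ e = 0 := by rw [dotProduct_comm, heu]
  simp only [planeRotation, Matrix.add_mulVec, Matrix.sub_mulVec, Matrix.smul_mulVec,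
    Matrix.one_mulVec, Matrix.vecMulVec_mulVec, he, hue]
  ext i
  simp
  ring

lemma planeRotation_mulVec_of_orthogonal {v : n → ℝ} (he : e ⬝ᵥ v = 0) (hu : u ⬝ᵥ v = 0)
    (t : ℝ) : planeRotation e u t *ᵥ v = v := by
  simp [planeRotation, Matrix.add_mulVec, Matrix.sub_mulVec, Matrix.smul_mulVec,
    Matrix.vecMulVec_mulVec, he, hu]

end planeRotation

lemma transpose_mul_mul_apply_self {n : Type*} [Fintype n] [DecidableEq n]
    (U A : Matrix n n ℝ) (i : n) :
    (Uᵀ * A * U) i i = (U *ᵥ Pi.single i 1) ⬝ᵥ (A *ᵥ (U *ᵥ Pi.single i 1)) := by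
  rw [Matrix.mulVec_mulVec, Matrix.mulVec_single_one, Matrix.mulVec_single_one, mul_assoc]
  rfl

section hollow

variable {n : Type*} [Fintype n] [DecidableEq n]

/-- Near a matrix `A₀` with `A₀ r r = 0`, a small rotation towards a unit vector `u` annihilates the
diagonal entry at `r`, provided the quadratic form has the opposite sign at `u`. -/
lemma eventually_exists_rotation {A₀ : Matrix n n ℝ} {r : n} {u : n → ℝ} (hr : A₀ r r = 0)
    (hu : u ⬝ᵥ u = 1) (hur : u r = 0)
    (hne : u ⬝ᵥ (A₀ *ᵥ u) ≠ 0 ∨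
      Pi.single r 1 ⬝ᵥ (A₀ *ᵥ u) + u ⬝ᵥ (A₀ *ᵥ Pi.single r 1) ≠ 0)
    {W : Set (Matrix n n ℝ)} (hW : W ∈ 𝓝 1) :
    ∀ᶠ B in 𝓝 A₀, B r r * (u ⬝ᵥ (B *ᵥ u)) ≤ 0 →
      ∃ U ∈ W, U * Uᵀ = 1 ∧ (Uᵀ * B * U) r r = 0 ∧
        ∀ i, i ≠ r → u i = 0 → (Uᵀ * B * U) i i = B i i := by
  set e : n → ℝ := Pi.single r 1 with he_def
  have he : e ⬝ᵥ e = 1 := by simp [he_def]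
  have heu : e ⬝ᵥ u = 0 := by simp [he_def, hur]
  have hrot : ∀ᶠ t in 𝓝 (0 : ℝ), planeRotation e u t ∈ W :=
    continuous_planeRotation.continuousAt.eventually (by rwa [planeRotation_zero])
  obtain ⟨ρ, hρ, hball⟩ := Metric.eventually_nhds_iff.1 hrot
  have hτ : Continuous fun B : Matrix n n ℝ => |B r r| := by fun_prop
  have hκ : Continuous fun B : Matrix n n ℝ => u ⬝ᵥ (B *ᵥ u) := by fun_prop
  have hx : Continuous fun B : Matrix n n ℝ => e ⬝ᵥ (B *ᵥ u) + u ⬝ᵥ (B *ᵥ e) := by fun_prop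
  have hsmall : ∀ᶠ B in 𝓝 A₀,
      |B r r| < |u ⬝ᵥ (B *ᵥ u)| * ρ ^ 2 ∨
        |B r r| < |e ⬝ᵥ (B *ᵥ u) + u ⬝ᵥ (B *ᵥ e)| * ρ := by
    rcases hne with h | h
    · refine ((hτ.tendsto A₀).eventually_lt ((hκ.abs.mul_const _).tendsto A₀) ?_).mono
        fun _ => Or.inl
      simp only [hr, abs_zero]
      positivity
    · refine ((hτ.tendsto A₀).eventually_lt ((hx.abs.mul_const _).tendsto A₀) ?_).mono
        fun _ => Or.inr
      simp only [hr, abs_zero]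
      positivity
  filter_upwards [hsmall] with B hB hsign
  obtain ⟨t, h0, h1, h2⟩ := exists_small_root_of_mul_nonpos hsign
    (x := e ⬝ᵥ (B *ᵥ u) + u ⬝ᵥ (B *ᵥ e)) (by
      by_contra! hcon
      rw [hcon.1, hcon.2] at hB
      have := abs_nonneg (B r r)
      simp at hB
      linarith)
  have ht : |t| < ρ := by
    rcases hB with hB | hB
    · exact abs_lt_of_sq_lt_sq (lt_of_mul_lt_mul_left (h2.trans_lt hB) (abs_nonneg _)) hρ.le
    · exact lt_of_mul_lt_mul_left (h1.trans_lt hB) (abs_nonneg _)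
  refine ⟨planeRotation e u t, hball (by simpa using ht),
    planeRotation_mul_transpose he hu heu t, ?_, fun i hir hui => ?_⟩
  · have hBr : e ⬝ᵥ (B *ᵥ e) = B r r := by simp [he_def]
    rw [transpose_mul_mul_apply_self, planeRotation_mulVec_left he heu]
    simp only [Matrix.mulVec_smul, Matrix.mulVec_add, smul_dotProduct, dotProduct_smul,
      add_dotProduct, dotProduct_add, smul_eq_mul, hBr]
    linear_combination ((√(1 + t ^ 2))⁻¹) ^ 2 * h0
  · rw [transpose_mul_mul_apply_self, planeRotation_mulVec_of_orthogonal]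
    · simp
    · simp [he_def, hir]
    · simp [hui]

lemma tendsto_transpose_mul_mul (A₀ : Matrix n n ℝ) :
    Tendsto (fun P : Matrix n n ℝ × Matrix n n ℝ => P.1ᵀ * P.2 * P.1) (𝓝 1 ×ˢ 𝓝 A₀) (𝓝 A₀) := by
  have h : Continuous fun P : Matrix n n ℝ × Matrix n n ℝ => P.1ᵀ * P.2 * P.1 := by fun_prop
  simpa [nhds_prod_eq] using h.tendsto (1, A₀)

/-- Successive small orthogonal conjugations compose to a small one. -/
lemma eventually_exists_conj_trans {A₀ : Matrix n n ℝ} {P Q : Matrix n n ℝ → Matrix n n ℝ → Prop}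
    (hP : ∀ W ∈ 𝓝 (1 : Matrix n n ℝ), ∀ᶠ A in 𝓝 A₀, ∃ U ∈ W, U * Uᵀ = 1 ∧ P A (Uᵀ * A * U))
    (hQ : ∀ W ∈ 𝓝 (1 : Matrix n n ℝ), ∀ᶠ A in 𝓝 A₀, ∀ A', P A' A →
      ∃ U ∈ W, U * Uᵀ = 1 ∧ Q A' (Uᵀ * A * U))
    (W : Set (Matrix n n ℝ)) (hW : W ∈ 𝓝 1) :
    ∀ᶠ A in 𝓝 A₀, ∃ U ∈ W, U * Uᵀ = 1 ∧ Q A (Uᵀ * A * U) := by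
  have hmul : Tendsto (fun V : Matrix n n ℝ × Matrix n n ℝ => V.1 * V.2) (𝓝 1 ×ˢ 𝓝 1) (𝓝 1) := by
    have h : Continuous fun V : Matrix n n ℝ × Matrix n n ℝ => V.1 * V.2 := by fun_prop
    simpa [nhds_prod_eq] using h.tendsto (1, 1)
  obtain ⟨W₁, hW₁, W₂, hW₂, hW₁₂⟩ := Filter.mem_prod_iff.1 (hmul hW)
  obtain ⟨W₃, hW₃, N, hN, hWN⟩ :=
    Filter.mem_prod_iff.1 (tendsto_transpose_mul_mul A₀ (hQ W₂ hW₂))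
  filter_upwards [hP _ (inter_mem hW₁ hW₃), hN] with A ⟨U, hU, hUU, hPU⟩ hA
  obtain ⟨V, hV, hVV, hQV⟩ := hWN (Set.mk_mem_prod hU.2 hA) A hPU
  refine ⟨U * V, hW₁₂ (Set.mk_mem_prod hU.1 hV), ?_, ?_⟩
  · rw [Matrix.transpose_mul, mul_assoc, ← mul_assoc V, hVV, one_mul, hUU]
  · simpa only [Matrix.transpose_mul, mul_assoc] using hQV

/-- Near a hollow matrix with `A₀ p q + A₀ q p ≠ 0`, a small orthogonal conjugation annihilates the
diagonal entries away from `p` and `q`. -/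
lemma eventually_exists_hollow_on {A₀ : Matrix n n ℝ} (hA₀ : ∀ i, A₀ i i = 0) {p q : n}
    (hpq : p ≠ q) (hne : A₀ p q + A₀ q p ≠ 0) (T : Finset n) (hp : p ∉ T) (hq : q ∉ T) :
    ∀ W ∈ 𝓝 (1 : Matrix n n ℝ), ∀ᶠ A in 𝓝 A₀,
      ∃ U ∈ W, U * Uᵀ = 1 ∧ ∀ i ∈ T, (Uᵀ * A * U) i i = 0 := by
  induction T using Finset.induction_on with
  | empty => exact fun W hW => .of_forall fun A => ⟨1, mem_of_mem_nhds hW, by simp⟩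
  | insert r T hrT ih =>
    simp only [Finset.mem_insert, not_or] at hp hq
    refine eventually_exists_conj_trans (P := fun _ B => ∀ i ∈ T, B i i = 0)
      (Q := fun _ B => ∀ i ∈ insert r T, B i i = 0)
      (ih hp.2 hq.2) fun W hW => ?_
    set u : ℝ → n → ℝ := fun σ => (√2)⁻¹ • (Pi.single p 1 + σ • Pi.single q 1) with hu_def
    have h2 : (√2)⁻¹ * (√2)⁻¹ = (2 : ℝ)⁻¹ := by
      rw [← mul_inv, Real.mul_self_sqrt (by norm_num)]
    have hform (σ : ℝ) (B : Matrix n n ℝ) : u σ ⬝ᵥ (B *ᵥ u σ) =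
        2⁻¹ * (B p p + σ * (B p q + B q p) + σ ^ 2 * B q q) := by
      simp only [hu_def, Matrix.mulVec_smul, Matrix.mulVec_add, smul_dotProduct, dotProduct_smul,
        add_dotProduct, dotProduct_add, smul_eq_mul, Matrix.mulVec_single_one,
        single_one_dotProduct, Matrix.col_apply]
      linear_combination (B p p + σ * (B p q + B q p) + σ ^ 2 * B q q) * h2
    have hunit (σ : ℝ) (hσ : σ ^ 2 = 1) : u σ ⬝ᵥ u σ = 1 := by
      have := hform σ 1
      simp only [Matrix.one_mulVec] at this
      rw [this]
      simp [hpq, hpq.symm, hσ]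
      norm_num
    have hzero (σ : ℝ) (i : n) (hip : i ≠ p) (hiq : i ≠ q) : u σ i = 0 := by
      simp [hu_def, hip, hiq]
    have hval (σ : ℝ) : u σ ⬝ᵥ (A₀ *ᵥ u σ) = 2⁻¹ * (σ * (A₀ p q + A₀ q p)) := by
      rw [hform, hA₀, hA₀]; ring
    have hstep (σ : ℝ) (hσ : σ ^ 2 = 1) := eventually_exists_rotation (hA₀ r) (hunit σ hσ)
      (hzero σ r (Ne.symm hp.1) (Ne.symm hq.1)) (.inl (by
        rw [hval]
        have : σ ≠ 0 := by rintro rfl; norm_num at hσ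
        positivity)) hW
    have hopp : ∀ᶠ B in 𝓝 A₀, (u 1 ⬝ᵥ (B *ᵥ u 1)) * (u (-1) ⬝ᵥ (B *ᵥ u (-1))) < 0 := by
      have hc : Continuous fun B : Matrix n n ℝ =>
          (u 1 ⬝ᵥ (B *ᵥ u 1)) * (u (-1) ⬝ᵥ (B *ᵥ u (-1))) := by fun_prop
      refine (hc.tendsto A₀).eventually_lt_const ?_
      rw [hval, hval]
      have := sq_pos_of_ne_zero hne
      linarith
    filter_upwards [hstep 1 (by norm_num), hstep (-1) (by norm_num), hopp] with B h₁ h₂ h₃ _ hT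
    have hfinish (σ : ℝ) (h : ∃ U ∈ W, U * Uᵀ = 1 ∧ (Uᵀ * B * U) r r = 0 ∧
        ∀ i, i ≠ r → u σ i = 0 → (Uᵀ * B * U) i i = B i i) :
        ∃ U ∈ W, U * Uᵀ = 1 ∧ ∀ i ∈ insert r T, (Uᵀ * B * U) i i = 0 := by
      obtain ⟨U, hUW, hU, hr, hrest⟩ := h
      refine ⟨U, hUW, hU, Finset.forall_mem_insert .. |>.2 ⟨hr, fun i hi => ?_⟩⟩
      rw [hrest i (ne_of_mem_of_not_mem hi hrT) (hzero σ i (ne_of_mem_of_not_mem hi hp.2)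
        (ne_of_mem_of_not_mem hi hq.2)), hT i hi]
    rcases le_or_gt (B r r * (u 1 ⬝ᵥ (B *ᵥ u 1))) 0 with h | h
    · exact hfinish 1 (h₁ h)
    · refine hfinish (-1) (h₂ ?_)
      by_contra! h'
      nlinarith [mul_pos h h', sq_nonneg (B r r)]

/-- Near a hollow matrix with nonzero symmetric part, every trace-zero matrix is made hollow by a
small orthogonal conjugation. -/
lemma eventually_exists_hollow {A₀ : Matrix n n ℝ} (hA₀ : ∀ i, A₀ i i = 0) {p q : n}
    (hpq : p ≠ q) (hne : A₀ p q + A₀ q p ≠ 0) {W : Set (Matrix n n ℝ)} (hW : W ∈ 𝓝 1) :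
    ∀ᶠ A in 𝓝 A₀, A.trace = 0 → ∃ U ∈ W, U * Uᵀ = 1 ∧ ∀ i, (Uᵀ * A * U) i i = 0 := by
  have htrace {U A : Matrix n n ℝ} (hU : U * Uᵀ = 1) : (Uᵀ * A * U).trace = A.trace := by
    rw [Matrix.trace_mul_comm, ← mul_assoc, hU, one_mul]
  have key := eventually_exists_conj_trans (A₀ := A₀)
    (P := fun _ B => ∀ i ∈ (Finset.univ.erase p).erase q, B i i = 0)
    (Q := fun _ B => B.trace = 0 → ∀ i, B i i = 0)
    (eventually_exists_hollow_on hA₀ hpq hne _ (by simp) (by simp)) (fun W hW => ?_) W hW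
  · filter_upwards [key] with A ⟨U, hUW, hU, h⟩ hA
    exact ⟨U, hUW, hU, h (by rw [htrace hU, hA])⟩
  · filter_upwards [eventually_exists_rotation (u := Pi.single q 1) (hA₀ p) (by simp)
      (by simp [hpq]) (.inr (by simpa using hne)) hW] with B hB _ hzero
    by_cases hBt : B.trace = 0
    · have hsum {C : Matrix n n ℝ} (hC : ∀ i, i ≠ p → i ≠ q → C i i = 0) :
          C.trace = C p p + C q q := by
        rw [Matrix.trace, ← Finset.sum_subset (Finset.subset_univ {p, q}), Finset.sum_pair hpq]
        · rfl
        · intro i _ hi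
          simp only [Finset.mem_insert, Finset.mem_singleton, not_or] at hi
          exact hC i hi.1 hi.2
      have hB0 : ∀ i, i ≠ p → i ≠ q → B i i = 0 := fun i hp hq => hzero i (by simp [hp, hq])
      have hBpq := hsum hB0
      rw [hBt] at hBpq
      obtain ⟨U, hUW, hU, hp0, hrest⟩ := hB (by
        simp only [Matrix.mulVec_single_one, single_one_dotProduct, Matrix.col_apply]
        rw [eq_neg_of_add_eq_zero_right hBpq.symm]
        nlinarith [sq_nonneg (B p p)])
      refine ⟨U, hUW, hU, fun hUt i => ?_⟩
      have hU0 : ∀ i, i ≠ p → i ≠ q → (Uᵀ * B * U) i i = 0 := fun i hp hq => by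
        rw [hrest i hp (by simp [hq]), hB0 i hp hq]
      have hUpq := hsum hU0
      rw [hUt, hp0, zero_add] at hUpq
      by_cases hip : i = p
      · rw [hip, hp0]
      by_cases hiq : i = q
      · rw [hiq, ← hUpq]
      exact hU0 i hip hiq
    · exact ⟨1, mem_of_mem_nhds hW, by simp, fun h => absurd (by simpa using h) hBt⟩

end hollow

theorem stmt5 (ε M : ℝ) (hε : 0 < ε) (hM : 0 < M) (m : ℕ) (hm : 2 ≤ m) :
    ∃ δ : ℝ, 0 < δ ∧
      ∀ A : Matrix (Fin m) (Fin m) ℝ,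
        -- trace zero
        Matrix.trace A = 0 →
        -- the diagonal entries `e_i · A e_i` are all `< δ` in absolute value
        (∀ i, |A i i| < δ) →
        -- operator norm bound `‖A‖ ≤ M`
        ‖Matrix.toEuclideanCLM (𝕜 := ℝ) A‖ ≤ M →
        -- `‖A_sym⁻¹‖ ≤ M`, where `A_sym = (A + Aᵀ)/2`
        (∀ x : EuclideanSpace ℝ (Fin m),
          ‖x‖ ≤ M * ‖Matrix.toEuclideanCLM (𝕜 := ℝ) ((1/2 : ℝ) • (A + Aᵀ)) x‖) →
        ∃ U : Matrix (Fin m) (Fin m) ℝ,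
          U * Uᵀ = 1 ∧
          (∀ i, (Uᵀ * A * U) i i = 0) ∧
          ‖Matrix.toEuclideanCLM (𝕜 := ℝ) (Uᵀ * A * U - A)‖ < ε := by
  by_contra! hcon
  choose A htr hdiag hnorm hinv hbad using fun k : ℕ => hcon (1 / ((k : ℝ) + 1)) (by positivity)
  set Φ := (Matrix.toEuclideanCLM (n := Fin m) (𝕜 := ℝ)) with hΦ_def
  have hΦ : Continuous Φ :=
    LinearMap.continuous_of_finiteDimensional (Φ.toAlgEquiv.toLinearEquiv.toLinearMap)
  have hΦs : Continuous Φ.symm :=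
    LinearMap.continuous_of_finiteDimensional (Φ.symm.toAlgEquiv.toLinearEquiv.toLinearMap)
  have : ProperSpace (EuclideanSpace ℝ (Fin m) →L[ℝ] EuclideanSpace ℝ (Fin m)) :=
    FiniteDimensional.proper ℝ _
  have : FirstCountableTopology (Matrix (Fin m) (Fin m) ℝ) :=
    inferInstanceAs (FirstCountableTopology (Fin m → Fin m → ℝ))
  have hcompact : IsCompact (Φ.symm '' Metric.closedBall 0 M) :=
    (isCompact_closedBall _ _).image hΦs
  obtain ⟨A₀, -, φ, hφ, hlim⟩ := hcompact.tendsto_subseq (x := A) fun k =>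
    ⟨Φ (A k), by simpa using hnorm k, by simp⟩
  have hA₀ (i : Fin m) : A₀ i i = 0 := by
    have h1 : Tendsto (fun k => A (φ k) i i) atTop (𝓝 (A₀ i i)) :=
      ((continuous_id.matrix_elem i i).tendsto A₀).comp hlim
    have h2 : Tendsto (fun k => A (φ k) i i) atTop (𝓝 0) :=
      squeeze_zero_norm (fun k => (hdiag (φ k) i).le)
        (tendsto_one_div_add_atTop_nhds_zero_nat.comp hφ.tendsto_atTop)
    exact tendsto_nhds_unique h1 h2
  have hA₀inv (x : EuclideanSpace ℝ (Fin m)) :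
      ‖x‖ ≤ M * ‖Φ ((1/2 : ℝ) • (A₀ + A₀ᵀ)) x‖ := by
    have hc : Continuous fun B : Matrix (Fin m) (Fin m) ℝ =>
        M * ‖Φ ((1/2 : ℝ) • (B + Bᵀ)) x‖ := by
      have : Continuous fun B : Matrix (Fin m) (Fin m) ℝ => Φ ((1/2 : ℝ) • (B + Bᵀ)) :=
        hΦ.comp (by fun_prop)
      fun_prop
    exact ge_of_tendsto' ((hc.tendsto A₀).comp hlim) fun k => hinv (φ k) x
  obtain ⟨p, q, hne⟩ : ∃ p q, A₀ p q + A₀ q p ≠ 0 := by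
    by_contra! h
    have hz : A₀ + A₀ᵀ = 0 := by ext i j; exact h i j
    have := hA₀inv (EuclideanSpace.single ⟨0, by omega⟩ 1)
    rw [hz] at this
    simp at this
    linarith
  have hpq : p ≠ q := by
    rintro rfl
    simp [hA₀] at hne
  have hclose : ∀ᶠ P in 𝓝 (1 : Matrix (Fin m) (Fin m) ℝ) ×ˢ 𝓝 A₀,
      ‖Φ (P.1ᵀ * P.2 * P.1 - P.2)‖ < ε := by
    have hc : Continuous fun P : Matrix (Fin m) (Fin m) ℝ × Matrix (Fin m) (Fin m) ℝ =>
        ‖Φ (P.1ᵀ * P.2 * P.1 - P.2)‖ := (hΦ.comp (by fun_prop)).norm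
    rw [← nhds_prod_eq]
    exact (hc.tendsto (1, A₀)).eventually_lt_const (by simpa using hε)
  obtain ⟨W, hW, N, hN, hWN⟩ := Filter.mem_prod_iff.1 hclose
  obtain ⟨k, hk, hkN⟩ := (hlim.eventually
    ((eventually_exists_hollow hA₀ hpq hne hW).and hN)).exists
  obtain ⟨U, hUW, hU, hhollow⟩ := hk (htr _)
  have hlt := hWN (Set.mk_mem_prod hUW hkN)
  rw [Set.mem_ofPred_eq] at hlt
  exact (hbad (φ k) U hU hhollow).not_gt hlt
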